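/- Let k = l₁ + l₂ and let K₁ and K₂ be k×k real diagonal positive definite matrices such that K₂⁻¹ − K₁⁻¹ = K, where K is the block-diagonal matrix diag(A, B) with A an l₁×l₁ diagonal positive semidefinite matrix and B an l₂×l₂ diagonal negative definite matrix. Let D₁ and D₂ be k×k diagonal positive definite matrices with D₁ ⪯ K₁ and D₂ ⪯ K₂. Then D₁⁻¹ + K is positive definite; setting D̂₁ := (D₁⁻¹ + K)⁻¹, one has D̂₁ ⪯ K₂, and the k×k block-diagonal matrix G whose upper-left l₁×l₁ block is (D̂₁)_{l₁} and whose lower-right l₂×l₂ block is [D₂]_{l₂} satisfies G ⪯ K₂. -/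

import Mathlib

open Matrix

/-- The inverse of a diagonal matrix with nonzero diagonal entries is taken entrywise. -/
theorem Matrix.inv_diagonal_of_ne_zero {n 𝕜 : Type*} [Fintype n] [DecidableEq n] [Field 𝕜]
    {d : n → 𝕜} (hd : ∀ i, d i ≠ 0) : (diagonal d)⁻¹ = diagonal fun i => (d i)⁻¹ := by
  apply Matrix.inv_eq_right_inv
  rw [diagonal_mul_diagonal, ← diagonal_one]
  congr 1
  ext i
  exact mul_inv_cancel₀ (hd i)

/-- With `K₁, K₂` diagonal positive definite, `K₂⁻¹ − K₁⁻¹ = K = diag(A, B)`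
(`A` diagonal PSD, `B` diagonal negative definite), and diagonal positive
definite `D₁ ⪯ K₁`, `D₂ ⪯ K₂`: the matrix `D₁⁻¹ + K` is positive definite,
`D̂₁ = (D₁⁻¹ + K)⁻¹` satisfies `D̂₁ ⪯ K₂`, and
`G = diag((D̂₁)_{l₁}, [D₂]_{l₂})` satisfies `G ⪯ K₂`. -/
theorem G_le_K2_diagonal (l₁ l₂ : ℕ)
    (K₁ K₂ : Matrix (Fin l₁ ⊕ Fin l₂) (Fin l₁ ⊕ Fin l₂) ℝ)
    (hK₁_diag : K₁.IsDiag) (hK₁ : K₁.PosDef)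
    (hK₂_diag : K₂.IsDiag) (hK₂ : K₂.PosDef)
    (A : Matrix (Fin l₁) (Fin l₁) ℝ) (hA_diag : A.IsDiag) (hA : A.PosSemidef)
    (B : Matrix (Fin l₂) (Fin l₂) ℝ) (hB_diag : B.IsDiag) (hB : (-B).PosDef)
    (K : Matrix (Fin l₁ ⊕ Fin l₂) (Fin l₁ ⊕ Fin l₂) ℝ)
    (hK_def : K = Matrix.fromBlocks A 0 0 B)
    (hK : K₂⁻¹ - K₁⁻¹ = K)
    (D₁ D₂ : Matrix (Fin l₁ ⊕ Fin l₂) (Fin l₁ ⊕ Fin l₂) ℝ)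
    (hD₁_diag : D₁.IsDiag) (hD₁ : D₁.PosDef)
    (hD₂_diag : D₂.IsDiag) (hD₂ : D₂.PosDef)
    (hD₁_le : (K₁ - D₁).PosSemidef) (hD₂_le : (K₂ - D₂).PosSemidef)
    (Dhat : Matrix (Fin l₁ ⊕ Fin l₂) (Fin l₁ ⊕ Fin l₂) ℝ)
    (hDhat : Dhat = (D₁⁻¹ + K)⁻¹)
    (G : Matrix (Fin l₁ ⊕ Fin l₂) (Fin l₁ ⊕ Fin l₂) ℝ)
    (hG : G = Matrix.fromBlocks (Matrix.toBlocks₁₁ Dhat) 0 0 (Matrix.toBlocks₂₂ D₂)) :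
    (D₁⁻¹ + K).PosDef ∧ (K₂ - Dhat).PosSemidef ∧ (K₂ - G).PosSemidef := by
  obtain ⟨k₁, rfl⟩ : ∃ d, K₁ = diagonal d := ⟨_, hK₁_diag.diagonal_diag.symm⟩
  obtain ⟨k₂, rfl⟩ : ∃ d, K₂ = diagonal d := ⟨_, hK₂_diag.diagonal_diag.symm⟩
  obtain ⟨d₁, rfl⟩ : ∃ d, D₁ = diagonal d := ⟨_, hD₁_diag.diagonal_diag.symm⟩
  obtain ⟨d₂, rfl⟩ : ∃ d, D₂ = diagonal d := ⟨_, hD₂_diag.diagonal_diag.symm⟩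
  rw [posDef_diagonal_iff] at hK₁ hK₂ hD₁ hD₂
  rw [diagonal_sub, posSemidef_diagonal_iff] at hD₁_le hD₂_le
  have inv_le (i) : (k₁ i)⁻¹ ≤ (d₁ i)⁻¹ :=
    inv_anti₀ (hD₁ i) (sub_nonneg.mp (hD₁_le i))
  have inv_le_sum (i) : (k₂ i)⁻¹ ≤ (d₁ i)⁻¹ + ((k₂ i)⁻¹ - (k₁ i)⁻¹) := by
    linarith [inv_le i]
  have sum_pos (i) : 0 < (d₁ i)⁻¹ + ((k₂ i)⁻¹ - (k₁ i)⁻¹) :=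
    (inv_pos.mpr (hK₂ i)).trans_le (inv_le_sum i)
  have hsum : (diagonal d₁)⁻¹ + K =
      diagonal fun i => (d₁ i)⁻¹ + ((k₂ i)⁻¹ - (k₁ i)⁻¹) := by
    rw [← hK, inv_diagonal_of_ne_zero fun i => (hD₁ i).ne',
      inv_diagonal_of_ne_zero fun i => (hK₁ i).ne',
      inv_diagonal_of_ne_zero fun i => (hK₂ i).ne', diagonal_sub, diagonal_add]
  rw [hsum, inv_diagonal_of_ne_zero fun i => (sum_pos i).ne'] at hDhat
  have hat_le (i) : ((d₁ i)⁻¹ + ((k₂ i)⁻¹ - (k₁ i)⁻¹))⁻¹ ≤ k₂ i :=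
    inv_le_of_inv_le₀ (hK₂ i) (inv_le_sum i)
  have hG_diag : G = diagonal (Sum.elim
      (fun i => ((d₁ (.inl i))⁻¹ + ((k₂ (.inl i))⁻¹ - (k₁ (.inl i))⁻¹))⁻¹)
      fun i => d₂ (.inr i)) := by
    rw [hG, hDhat, ← fromBlocks_diagonal]
    congr 1 <;> ext i j <;> simp [toBlocks₁₁, toBlocks₂₂, diagonal_apply]
  refine ⟨?_, ?_, ?_⟩
  · rw [hsum, posDef_diagonal_iff]
    exact sum_pos
  · rw [hDhat, diagonal_sub, posSemidef_diagonal_iff]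
    exact fun i => sub_nonneg.mpr (hat_le i)
  · rw [hG_diag, diagonal_sub, posSemidef_diagonal_iff]
    rintro (i | i)
    · exact sub_nonneg.mpr (hat_le _)
    · exact hD₂_le _
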